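/- arXiv:2309.07663 — 2 statements merged into one kernel-verified Lean document; each statement's English description precedes it below -/
import Mathlib

section
/- Let $\rho > 0$ and $\eta \ge 0$, and define $\varepsilon_g : [0, \rho+\eta) \to \mathbb{R}$ by $\varepsilon_g(\beta) = \rho - \sqrt{\eta + \rho - \beta}\,(2\sqrt{\rho} - \sqrt{\eta + \rho - \beta})$. Then $\varepsilon_g(\beta) \ge 0$ for all $\beta \in [0, \rho+\eta)$, with equality if and only if $\beta = \eta$; i.e., $\varepsilon_g$ attains its unique minimum value $0$ at $\beta = \eta$. -/
/-- In the large dataset limit, the signal recovery error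
`εg β = ρ - √(η+ρ-β)(2√ρ - √(η+ρ-β))` is nonnegative on `[0, ρ+η)`, and is zero
iff `β = η`: the optimal beta equals the background noise strength. -/
theorem stmt_7 (ρ η : ℝ) (hρ : 0 < ρ) (hη : 0 ≤ η) :
    ∀ β : ℝ, 0 ≤ β → β < ρ + η →
      0 ≤ ρ - Real.sqrt (η + ρ - β) * (2 * Real.sqrt ρ - Real.sqrt (η + ρ - β))
      ∧ (ρ - Real.sqrt (η + ρ - β) * (2 * Real.sqrt ρ - Real.sqrt (η + ρ - β)) = 0
          ↔ β = η) := by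
  intro β _ hβ
  have hpos : 0 ≤ η + ρ - β := by linarith
  have key : ρ - Real.sqrt (η + ρ - β) * (2 * Real.sqrt ρ - Real.sqrt (η + ρ - β))
      = (Real.sqrt ρ - Real.sqrt (η + ρ - β)) ^ 2 := by
    linear_combination -Real.sq_sqrt hρ.le
  rw [key, sq_eq_zero_iff, sub_eq_zero, Real.sqrt_inj hρ.le hpos]
  exact ⟨sq_nonneg _, fun h => by linarith, fun h => by linarith⟩
end

section
/- Let $\rho > 0$, $\eta > 0$, and $0 < \beta < \rho + \eta$. Set $m = \sqrt{\rho + \eta - \beta}$ and $b = \frac{\sqrt{\rho + \eta - \beta}}{\rho + \eta}$. Then: (i) $\beta + (m^2 b^2 - 1)\eta + b^2(m^2 \rho + \beta(\eta + \rho)) = \rho$, so that $m = \frac{m\rho}{\beta + (m^2 b^2 - 1)\eta + b^2(m^2\rho + \beta(\eta+\rho))}$; and (ii) $\eta\rho b + \big(m - b(m^2+\beta)\big)\rho\Big(\frac{\beta}{m^2+\beta} + b^2(\eta+\rho)\Big) = \eta\rho b$ and $\eta\big(\beta - \eta + b^2(m^2+\beta)(\eta+\rho)\big) = \eta\rho$,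 so that $b = \frac{\eta\rho b + (m - b(m^2+\beta))\rho\big(\frac{\beta}{m^2+\beta} + b^2(\eta+\rho)\big)}{\eta\big(\beta - \eta + b^2(m^2+\beta)(\eta+\rho)\big)}$. Moreover $(m, b) = (0, 0)$ also satisfies both fixed-point equations. -/
/-- The learnable solution `m = √(ρ+η-β)`, `b = √(ρ+η-β)/(ρ+η)` satisfies the
infinite-data saddle-point (fixed-point) equations of the linear VAE on the spiked
covariance model, and `(m, b) = (0, 0)` (posterior collapse) is also a fixed point. -/
theorem stmt_13 (ρ η β : ℝ) (hρ : 0 < ρ) (hη : 0 < η) (hβ : 0 < β)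
    (hβlt : β < ρ + η) :
    let m : ℝ := Real.sqrt (ρ + η - β)
    let b : ℝ := Real.sqrt (ρ + η - β) / (ρ + η)
    -- (i) the `m`-equation
    (β + (m ^ 2 * b ^ 2 - 1) * η + b ^ 2 * (m ^ 2 * ρ + β * (η + ρ)) = ρ
      ∧ m = m * ρ / (β + (m ^ 2 * b ^ 2 - 1) * η + b ^ 2 * (m ^ 2 * ρ + β * (η + ρ))))
    -- (ii) the `b`-equation
    ∧ (η * ρ * b + (m - b * (m ^ 2 + β)) * ρ * (β / (m ^ 2 + β) + b ^ 2 * (η + ρ))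
          = η * ρ * b
      ∧ η * (β - η + b ^ 2 * (m ^ 2 + β) * (η + ρ)) = η * ρ
      ∧ b = (η * ρ * b
              + (m - b * (m ^ 2 + β)) * ρ * (β / (m ^ 2 + β) + b ^ 2 * (η + ρ)))
            / (η * (β - η + b ^ 2 * (m ^ 2 + β) * (η + ρ))))
    -- (m, b) = (0, 0) is also a fixed point of both equations
    ∧ ((0 : ℝ)
          = 0 * ρ / (β + ((0 : ℝ) ^ 2 * (0 : ℝ) ^ 2 - 1) * η
              + (0 : ℝ) ^ 2 * ((0 : ℝ) ^ 2 * ρ + β * (η + ρ)))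
      ∧ (0 : ℝ)
          = (η * ρ * 0
              + ((0 : ℝ) - 0 * ((0 : ℝ) ^ 2 + β)) * ρ
                  * (β / ((0 : ℝ) ^ 2 + β) + (0 : ℝ) ^ 2 * (η + ρ)))
            / (η * (β - η + (0 : ℝ) ^ 2 * ((0 : ℝ) ^ 2 + β) * (η + ρ)))) := by
  intro m b
  have hs : ρ + η ≠ 0 := by positivity
  have hm : m ^ 2 + β = ρ + η := by
    have : m ^ 2 = ρ + η - β := Real.sq_sqrt (by linarith)
    linarith
  have hmb : m = b * (ρ + η) := (div_mul_cancel₀ _ hs).symm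
  have hb : b ^ 2 * (ρ + η) ^ 2 = ρ + η - β := by
    rw [← mul_pow, ← hmb]
    linarith
  have hmden : β + (m ^ 2 * b ^ 2 - 1) * η + b ^ 2 * (m ^ 2 * ρ + β * (η + ρ)) = ρ := by
    linear_combination hb + b ^ 2 * (ρ + η) * hm
  have hbnum : η * ρ * b + (m - b * (m ^ 2 + β)) * ρ * (β / (m ^ 2 + β) + b ^ 2 * (η + ρ))
      = η * ρ * b := by
    rw [hm, ← hmb]
    ring
  have hbden : η * (β - η + b ^ 2 * (m ^ 2 + β) * (η + ρ)) = η * ρ := by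
    linear_combination η * hb + η * b ^ 2 * (ρ + η) * hm
  refine ⟨⟨hmden, ?_⟩, ⟨hbnum, hbden, ?_⟩, by simp, by simp⟩
  · rw [hmden, mul_div_cancel_right₀ _ hρ.ne']
  · rw [hbnum, hbden, mul_div_cancel_left₀ _ (mul_pos hη hρ).ne']
end
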